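/- Let G be a perfect unmixed finite simple graph on vertices x_1,…,x_n with no isolated vertices and let J = I_c(G). Then the all-ones vector (1,…,1,1) ∈ ℝ^{n+1} lies in the topological interior of the Rees cone ℝ₊(J), and every integral vector (a,b) ∈ ℤ^{n+1} lying in the topological interior of ℝ₊(J) satisfies (a,b) − (1,…,1,1) ∈ ℝ₊(J) ∩ ℤ^{n+1}. Consequently the set of monomials x^a t^b with (a,b) an interior lattice point of ℝ₊(J) is exactly the set of multiples of x_1⋯x_n t by monomials of the Rees algebra R[Jt]. -/

import Mathlib

open Finset

/-- A vertex cover of a graph: a set of vertices meeting every edge. -/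
def IsVCover {n : ℕ} (G : SimpleGraph (Fin n)) (C : Finset (Fin n)) : Prop :=
  ∀ ⦃a b : Fin n⦄, G.Adj a b → a ∈ C ∨ b ∈ C

/-- A minimal vertex cover: no proper subset is a vertex cover. -/
def IsMinVCover {n : ℕ} (G : SimpleGraph (Fin n)) (C : Finset (Fin n)) : Prop :=
  IsVCover G C ∧ ∀ D : Finset (Fin n), D ⊂ C → ¬ IsVCover G D

/-- The clique number of a graph: maximal size of a clique. -/
noncomputable def cliqueNumber {V : Type*} (G : SimpleGraph V) : ℕ :=
  sSup { k : ℕ | ∃ t : Finset V, G.IsNClique k t }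

/-- A graph is perfect if for every induced subgraph the chromatic number
equals the clique number. -/
def IsPerfect {V : Type*} (G : SimpleGraph V) : Prop :=
  ∀ s : Set V, (G.induce s).chromaticNumber = (cliqueNumber (G.induce s) : ℕ∞)

/-- The Rees cone of the ideal of vertex covers `I_c(G)`: all non-negative real
combinations of the unit vectors `e_1,…,e_n` and the vectors `(u_C, 1)` where
`u_C` runs over incidence vectors of minimal vertex covers of `G`. Vectors of
`ℝ^{n+1}` are represented as pairs `(a, a_{n+1}) : (Fin n → ℝ) × ℝ`. -/
def reesCone {n : ℕ} (G : SimpleGraph (Fin n)) : Set ((Fin n → ℝ) × ℝ) :=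
  { v | ∃ (c : Fin n → ℝ) (d : Finset (Fin n) → ℝ),
      (∀ i, 0 ≤ c i) ∧ (∀ C, 0 ≤ d C) ∧
      (∀ C, d C ≠ 0 → IsMinVCover G C) ∧
      (∀ i, v.1 i = c i + ∑ C : Finset (Fin n), d C * (if i ∈ C then 1 else 0)) ∧
      v.2 = ∑ C : Finset (Fin n), d C }


/-- `G` is unmixed: all minimal vertex covers have the same cardinality. -/
def Unmixed {n : ℕ} (G : SimpleGraph (Fin n)) : Prop :=
  ∀ C D : Finset (Fin n), IsMinVCover G C → IsMinVCover G D → C.card = D.card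

/-- `z ∈ ℕA'`: the integral vector `z ∈ ℤ^{n+1}` is a non-negative integer
combination of `A' = {e_1,…,e_n, (u_1,1),…,(u_s,1)}`; such `z` correspond
exactly to the monomials `x^{z.1} t^{z.2}` of the Rees algebra `R[I_c(G)t]`. -/
def IsNNCombA' {n : ℕ} (G : SimpleGraph (Fin n)) (z : (Fin n → ℤ) × ℤ) : Prop :=
  ∃ (c : Fin n → ℕ) (d : Finset (Fin n) → ℕ),
    (∀ C, d C ≠ 0 → IsMinVCover G C) ∧
    (∀ i, z.1 i = (c i : ℤ) + ∑ C : Finset (Fin n), (d C : ℤ) * (if i ∈ C then 1 else 0)) ∧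
    z.2 = ∑ C : Finset (Fin n), (d C : ℤ)

section GraphLemmas

variable {n : ℕ} {G : SimpleGraph (Fin n)}

/-- A clique and an independent set meet in at most one vertex. -/
lemma card_filter_mem_le_one {K S : Finset (Fin n)} (hK : G.IsClique (K : Set (Fin n)))
    (hS : ∀ a ∈ S, ∀ b ∈ S, ¬ G.Adj a b) : #{i ∈ K | i ∈ S} ≤ 1 := by
  refine Finset.card_le_one.2 fun a ha b hb => ?_
  rw [Finset.mem_filter] at ha hb
  by_contra hab
  exact hS a ha.2 b hb.2 (hK ha.1 hb.1 hab)

/-- A family of independent sets covers a clique at most as often as it has members. -/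
lemma sum_countP_le_card {K : Finset (Fin n)} (hK : G.IsClique (K : Set (Fin n)))
    (L : Multiset (Finset (Fin n))) (hL : ∀ S ∈ L, ∀ a ∈ S, ∀ b ∈ S, ¬ G.Adj a b) :
    ∑ i ∈ K, L.countP (i ∈ ·) ≤ L.card := by
  induction L using Multiset.induction_on with
  | empty => simp
  | cons S L ih =>
    have hS := card_filter_mem_le_one hK (hL S (Multiset.mem_cons_self S L))
    have hi := ih fun T hT => hL T (Multiset.mem_cons_of_mem hT)
    simp only [Multiset.countP_cons, Finset.sum_add_distrib, Multiset.card_cons]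
    rw [← Finset.card_filter]
    omega

/-- Perfection, phrased for the vertices selected by a `0`-`1` weight. -/
lemma IsPerfect.exists_cover_of_le_one (hperf : IsPerfect G) (m : Fin n → ℕ) (b : ℕ)
    (hm : ∀ i, m i ≤ 1)
    (hK : ∀ K : Finset (Fin n), G.IsClique (K : Set (Fin n)) → ∑ i ∈ K, m i ≤ b) :
    ∃ L : Multiset (Finset (Fin n)), L.card = b ∧
      (∀ S ∈ L, ∀ a ∈ S, ∀ b ∈ S, ¬ G.Adj a b) ∧ ∀ i, m i ≤ L.countP (i ∈ ·) := by
  classical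
  set s : Set (Fin n) := {i | m i = 1}
  have hclique : cliqueNumber (G.induce s) ≤ b := by
    refine csSup_le' ?_
    rintro k ⟨t, ht⟩
    have h := hK (t.map (Function.Embedding.subtype _)) (by
      intro x hx y hy hxy
      simp only [Finset.coe_map, Set.mem_image, Finset.mem_coe] at hx hy
      obtain ⟨x, hx, rfl⟩ := hx
      obtain ⟨y, hy, rfl⟩ := hy
      exact ht.isClique hx hy (fun h => hxy (by rw [h])))
    rw [Finset.sum_map, Finset.sum_congr rfl (fun x _ => show m _ = 1 from x.2)] at h
    simpa [ht.card_eq] using h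
  have hcol : (G.induce s).Colorable b := by
    rw [← SimpleGraph.chromaticNumber_le_iff_colorable, hperf s]
    exact_mod_cast hclique
  obtain ⟨col⟩ := hcol
  refine ⟨(Finset.univ : Finset (Fin b)).val.map
    (fun j => Finset.univ.filter fun i => ∃ h : i ∈ s, col ⟨i, h⟩ = j), by simp, ?_, ?_⟩
  · intro S hS x hx y hy hxy
    obtain ⟨j, -, rfl⟩ := Multiset.mem_map.1 hS
    simp only [Finset.mem_filter, Finset.mem_univ, true_and] at hx hy
    obtain ⟨hxs, hx⟩ := hx
    obtain ⟨hys, hy⟩ := hy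
    exact col.valid (v := ⟨x, hxs⟩) (w := ⟨y, hys⟩) hxy (hx.trans hy.symm)
  · intro i
    by_cases hi : m i = 1
    · rw [hi, Nat.one_le_iff_ne_zero, ← Nat.pos_iff_ne_zero, Multiset.countP_pos]
      exact ⟨_, Multiset.mem_map_of_mem _ (Finset.mem_univ_val (col ⟨i, hi⟩)),
        Finset.mem_filter.2 ⟨Finset.mem_univ i, hi, rfl⟩⟩
    · have := hm i
      omega

/-- Lovász replication: if every clique of a perfect graph has weight at most `b`, then some `b`
independent sets cover every vertex at least as often as its weight. -/
lemma IsPerfect.exists_cover (hperf : IsPerfect G) (m : Fin n → ℕ) (b : ℕ)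
    (hK : ∀ K : Finset (Fin n), G.IsClique (K : Set (Fin n)) → ∑ i ∈ K, m i ≤ b) :
    ∃ L : Multiset (Finset (Fin n)), L.card = b ∧
      (∀ S ∈ L, ∀ a ∈ S, ∀ b ∈ S, ¬ G.Adj a b) ∧ ∀ i, m i ≤ L.countP (i ∈ ·) := by
  induction hN : ∑ i, m i using Nat.strong_induction_on generalizing m b with
  | _ N ih =>
  by_cases hm : ∀ i, m i ≤ 1
  · exact hperf.exists_cover_of_le_one m b hm hK
  push Not at hm
  obtain ⟨x, hx⟩ := hm
  set m₁ : Fin n → ℕ := fun i => m i - if i = x then 1 else 0 with hm₁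
  have hm₁lt : ∑ i, m₁ i < N := by
    rw [← hN]
    refine Finset.sum_lt_sum (fun i _ => Nat.sub_le _ _) ⟨x, Finset.mem_univ x, ?_⟩
    simp only [hm₁, if_true]
    omega
  obtain ⟨L, hLb, hL, hLm⟩ := ih _ hm₁lt m₁ b
    (fun K h => (Finset.sum_le_sum fun i _ => Nat.sub_le _ _).trans (hK K h)) rfl
  obtain ⟨S, hSL, hxS⟩ : ∃ S ∈ L, x ∈ S := by
    rw [← Multiset.countP_pos (p := (x ∈ ·))]
    have := hLm x
    simp only [hm₁, if_true] at this
    omega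
  obtain ⟨L', rfl⟩ := Multiset.exists_cons_of_mem hSL
  have hS := hL S hSL
  have hL' : ∀ T ∈ L', ∀ a ∈ T, ∀ b ∈ T, ¬ G.Adj a b :=
    fun T hT => hL T (Multiset.mem_cons_of_mem hT)
  rw [Multiset.card_cons] at hLb
  set m₂ : Fin n → ℕ := fun i => m i - if i ∈ S then 1 else 0 with hm₂
  have hm₂lt : ∑ i, m₂ i < N := by
    rw [← hN]
    refine Finset.sum_lt_sum (fun i _ => Nat.sub_le _ _) ⟨x, Finset.mem_univ x, ?_⟩
    simp only [hm₂, if_pos hxS]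
    omega
  have hK₂ : ∀ K : Finset (Fin n), G.IsClique (K : Set (Fin n)) →
      ∑ i ∈ K, m₂ i ≤ L'.card := by
    intro K h
    by_cases hKS : ∃ i ∈ K, i ∈ S ∧ m i ≠ 0
    · obtain ⟨i, hiK, hiS, hi⟩ := hKS
      have hlt : ∑ i ∈ K, m₂ i < ∑ i ∈ K, m i := by
        refine Finset.sum_lt_sum (fun i _ => Nat.sub_le _ _) ⟨i, hiK, ?_⟩
        simp only [hm₂, if_pos hiS]
        omega
      have := hK K h
      omega
    · push Not at hKS
      refine le_trans (Finset.sum_le_sum fun i hi => ?_) (sum_countP_le_card h L' hL')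
      by_cases hiS : i ∈ S
      · simp [hm₂, hKS i hi hiS]
      · have hix : i ≠ x := fun h => hiS (h ▸ hxS)
        have := hLm i
        simpa [hm₁, hm₂, hiS, hix] using this
  obtain ⟨L₂, hL₂b, hL₂, hL₂m⟩ := ih _ hm₂lt m₂ L'.card hK₂ rfl
  refine ⟨S ::ₘ L₂, by rw [Multiset.card_cons]; omega, ?_, fun i => ?_⟩
  · intro T hT
    rcases Multiset.mem_cons.1 hT with rfl | hT
    · exact hS
    · exact hL₂ T hT
  · have := hL₂m i
    rw [Multiset.countP_cons]
    simp only [hm₂] at this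
    omega

/-- Every vertex cover contains a minimal one. -/
lemma IsVCover.exists_isMinVCover_subset {C : Finset (Fin n)} (hC : IsVCover G C) :
    ∃ D ⊆ C, IsMinVCover G D := by
  induction C using Finset.strongInduction with
  | H C ih =>
  by_cases h : ∃ D ⊂ C, IsVCover G D
  · obtain ⟨D, hDC, hD⟩ := h
    obtain ⟨E, hED, hE⟩ := ih D hDC hD
    exact ⟨E, hED.trans hDC.1, hE⟩
  · push Not at h
    exact ⟨C, Finset.Subset.refl C, hC, h⟩

/-- Every independent set is avoided by a minimal vertex cover. -/
lemma exists_isMinVCover_disjoint {S : Finset (Fin n)} (hS : ∀ a ∈ S, ∀ b ∈ S, ¬ G.Adj a b) :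
    ∃ C, IsMinVCover G C ∧ ∀ i ∈ S, i ∉ C := by
  have hcov : IsVCover G Sᶜ := by
    intro a b hab
    by_contra! h
    simp only [Finset.mem_compl, not_not] at h
    exact hS a h.1 b h.2 hab
  obtain ⟨C, hCS, hC⟩ := hcov.exists_isMinVCover_subset
  exact ⟨C, hC, fun i hi hiC => Finset.mem_compl.1 (hCS hiC) hi⟩

/-- A vertex cover misses at most one vertex of a clique. -/
lemma IsVCover.card_le_card_filter_add_one {K C : Finset (Fin n)} (hC : IsVCover G C)
    (hK : G.IsClique (K : Set (Fin n))) : #K ≤ #{i ∈ K | i ∈ C} + 1 := by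
  have h := card_filter_mem_le_one (S := Cᶜ) hK (by
    intro a ha b hb hab
    rw [Finset.mem_compl] at ha hb
    exact (hC hab).elim ha hb)
  simp only [Finset.mem_compl] at h
  have := Finset.card_filter_add_card_filter_not (s := K) (· ∈ C)
  omega

end GraphLemmas

section ReesCone

variable {n : ℕ} {G : SimpleGraph (Fin n)}

/-- The clique inequalities hold on the Rees cone. -/
lemma clique_inequality_of_mem_reesCone {v : (Fin n → ℝ) × ℝ} (hv : v ∈ reesCone G)
    {K : Finset (Fin n)} (hK : G.IsClique (K : Set (Fin n))) :
    ((#K : ℝ) - 1) * v.2 ≤ ∑ i ∈ K, v.1 i := by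
  obtain ⟨c, d, hc, hd, hmin, hv1, hv2⟩ := hv
  rw [hv2, Finset.sum_congr rfl fun i _ => hv1 i, Finset.sum_add_distrib, Finset.sum_comm,
    Finset.mul_sum]
  refine le_add_of_nonneg_of_le (Finset.sum_nonneg fun i _ => hc i)
    (Finset.sum_le_sum fun C _ => ?_)
  rw [← Finset.mul_sum, mul_comm, Finset.sum_boole]
  by_cases h0 : d C = 0
  · simp [h0]
  refine mul_le_mul_of_nonneg_left ?_ (hd C)
  have := (hmin C h0).1.card_le_card_filter_add_one hK
  rw [sub_le_iff_le_add]
  exact_mod_cast this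

/-- The clique inequalities are strict in the interior of the Rees cone. -/
lemma clique_inequality_of_mem_interior_reesCone {v : (Fin n → ℝ) × ℝ}
    (hv : v ∈ interior (reesCone G)) {K : Finset (Fin n)} (hK : G.IsClique (K : Set (Fin n))) :
    ((#K : ℝ) - 1) * v.2 < ∑ i ∈ K, v.1 i := by
  have hcont : Continuous fun ε : ℝ => ((fun i => v.1 i - ε, v.2 - ε) : (Fin n → ℝ) × ℝ) := by
    fun_prop
  have hev := hcont.continuousAt (x := 0) |>.preimage_mem_nhds
    (t := reesCone G) (by simpa using mem_interior_iff_mem_nhds.1 hv)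
  obtain ⟨ε, hmem, hε⟩ := Filter.nonempty_of_mem
    (Filter.inter_mem (nhdsWithin_le_nhds hev)
      (self_mem_nhdsWithin (a := (0 : ℝ)) (s := Set.Ioi 0)))
  have h := clique_inequality_of_mem_reesCone hmem hK
  simp only [Finset.sum_sub_distrib, Finset.sum_const, nsmul_eq_mul] at h
  have hε' : 0 < ε := hε
  nlinarith

/-- A combination of the generators with positive coefficients on all unit vectors and positive
last coordinate is an interior point. -/
lemma mem_interior_reesCone {v : (Fin n → ℝ) × ℝ} {d : Finset (Fin n) → ℝ}
    (hd : ∀ C, 0 ≤ d C) (hmin : ∀ C, d C ≠ 0 → IsMinVCover G C)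
    (hlt : ∀ i, ∑ C : Finset (Fin n), d C * (if i ∈ C then 1 else 0) < v.1 i)
    (hv2 : v.2 = ∑ C : Finset (Fin n), d C) (hpos : 0 < v.2) :
    v ∈ interior (reesCone G) := by
  set s : Fin n → ℝ := fun i => ∑ C : Finset (Fin n), d C * (if i ∈ C then 1 else 0) with hs
  have h1 : ∀ᶠ w : (Fin n → ℝ) × ℝ in nhds v, ∀ i, 0 < w.1 i - w.2 / v.2 * s i := by
    refine Filter.eventually_all.2 fun i => ?_
    have hcont : Continuous fun w : (Fin n → ℝ) × ℝ => w.1 i - w.2 / v.2 * s i := by fun_prop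
    refine continuousAt_const.eventually_lt hcont.continuousAt ?_
    rw [div_self hpos.ne', one_mul]
    exact sub_pos.2 (hlt i)
  have h2 : ∀ᶠ w : (Fin n → ℝ) × ℝ in nhds v, 0 < w.2 :=
    continuousAt_const.eventually_lt continuous_snd.continuousAt hpos
  rw [mem_interior_iff_mem_nhds]
  filter_upwards [h1, h2] with w hw1 hw2
  refine ⟨fun i => w.1 i - w.2 / v.2 * s i, fun C => w.2 / v.2 * d C, fun i => (hw1 i).le,
    fun C => mul_nonneg (div_pos hw2 hpos).le (hd C),
    fun C hC => hmin C (right_ne_zero_of_mul hC), fun i => ?_, ?_⟩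
  · simp only [hs, mul_assoc, ← Finset.mul_sum]
    ring
  · rw [← Finset.mul_sum, ← hv2, div_mul_cancel₀ _ hpos.ne']

/-- Some convex combination of the minimal vertex covers has all coordinates less than one. -/
lemma exists_convex_combination_lt_one (G : SimpleGraph (Fin n)) :
    ∃ d : Finset (Fin n) → ℝ, (∀ C, 0 ≤ d C) ∧ (∀ C, d C ≠ 0 → IsMinVCover G C) ∧
      (∀ i, ∑ C : Finset (Fin n), d C * (if i ∈ C then 1 else 0) < 1) ∧
      ∑ C : Finset (Fin n), d C = 1 := by
  classical
  set F : Finset (Finset (Fin n)) := Finset.univ.filter (IsMinVCover G) with hF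
  have hcard : 0 < (#F : ℝ) := by
    obtain ⟨C, hC, -⟩ := exists_isMinVCover_disjoint (G := G) (S := ∅) (by simp)
    exact_mod_cast Finset.card_pos.2 ⟨C, by simpa [hF] using hC⟩
  have hsum : ∑ C : Finset (Fin n), (if IsMinVCover G C then (#F : ℝ)⁻¹ else 0) = 1 := by
    rw [← Finset.sum_filter, Finset.sum_const, nsmul_eq_mul, mul_inv_cancel₀ hcard.ne']
  refine ⟨fun C => if IsMinVCover G C then (#F : ℝ)⁻¹ else 0, fun C => ?_, fun C hC => ?_,
    fun i => ?_, hsum⟩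
  · dsimp only
    split_ifs <;> positivity
  · by_contra h
    simp [h] at hC
  · refine lt_of_lt_of_eq ?_ hsum
    obtain ⟨C, hC, hiC⟩ := exists_isMinVCover_disjoint (G := G) (S := {i}) (by simp)
    refine Finset.sum_lt_sum (fun D _ => ?_) ⟨C, Finset.mem_univ C, ?_⟩
    · dsimp only
      split_ifs <;> simp
    · simp [hC, hiC i (Finset.mem_singleton_self i), hcard]

/-- Translating the Rees cone by the all-ones vector moves it into its interior. -/
lemma add_one_mem_interior_reesCone {v : (Fin n → ℝ) × ℝ} (hv : v ∈ reesCone G) :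
    ((fun i => v.1 i + 1), v.2 + 1) ∈ interior (reesCone G) := by
  obtain ⟨c, d, hc, hd, hmin, hv1, hv2⟩ := hv
  obtain ⟨d₀, hd₀, hmin₀, hlt₀, hsum₀⟩ := exists_convex_combination_lt_one G
  refine mem_interior_reesCone (d := fun C => d C + d₀ C) (fun C => add_nonneg (hd C) (hd₀ C))
    (fun C hC => ?_) (fun i => ?_) ?_ ?_
  · by_cases h : d C = 0
    · exact hmin₀ C (by simpa [h] using hC)
    · exact hmin C h
  · simp only [add_mul, Finset.sum_add_distrib]
    have := hv1 i
    have := hc i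
    have := hlt₀ i
    linarith
  · simp only [Finset.sum_add_distrib, hv2, hsum₀]
  · have : 0 ≤ ∑ C : Finset (Fin n), d C := Finset.sum_nonneg fun C _ => hd C
    simp only [hv2]
    linarith

lemma IsNNCombA'.mem_reesCone {z : (Fin n → ℤ) × ℤ} (hz : IsNNCombA' G z) :
    ((fun i => (z.1 i : ℝ)), (z.2 : ℝ)) ∈ reesCone G := by
  obtain ⟨c, d, hmin, hz1, hz2⟩ := hz
  refine ⟨fun i => c i, fun C => d C, fun i => Nat.cast_nonneg _, fun C => Nat.cast_nonneg _,
    fun C hC => hmin C (Nat.cast_ne_zero.1 hC), fun i => ?_, ?_⟩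
  · simp only [hz1 i]
    push_cast
    rfl
  · simp only [hz2]
    push_cast
    rfl

/-- Summing multiplicities over the members of a multiset that contain `i`. -/
lemma sum_count_mul_ite (M : Multiset (Finset (Fin n))) (i : Fin n) :
    ∑ C : Finset (Fin n), (M.count C : ℤ) * (if i ∈ C then 1 else 0) = M.countP (i ∈ ·) := by
  induction M using Multiset.induction_on with
  | empty => simp
  | cons S M ih =>
    simp only [Multiset.count_cons, Multiset.countP_cons, Nat.cast_add, add_mul,
      Finset.sum_add_distrib, ih]
    rw [Finset.sum_eq_single S (fun C _ hC => by simp [hC]) (by simp)]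
    simp

/-- For a perfect graph the clique inequalities describe the lattice points of `ℕA'`. -/
lemma IsPerfect.isNNCombA' (hperf : IsPerfect G) {z : (Fin n → ℤ) × ℤ}
    (hz : ∀ K : Finset (Fin n), G.IsClique (K : Set (Fin n)) →
      ((#K : ℤ) - 1) * z.2 ≤ ∑ i ∈ K, z.1 i) : IsNNCombA' G z := by
  classical
  obtain ⟨b, hb⟩ : ∃ b : ℕ, z.2 = b :=
    Int.eq_ofNat_of_zero_le (by simpa using hz ∅ (by simp))
  have ha : ∀ i, 0 ≤ z.1 i := fun i => by simpa using hz {i} (by simp)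
  obtain ⟨L, hLb, hL, hLm⟩ := hperf.exists_cover (fun i => (z.2 - z.1 i).toNat) b (by
    intro K hK
    have h := hz (K.filter fun i => z.1 i < z.2)
      (hK.subset (Finset.coe_subset.2 (Finset.filter_subset _ K)))
    have hsum : ((∑ i ∈ K, (z.2 - z.1 i).toNat : ℕ) : ℤ)
        = ∑ i ∈ K.filter (fun i => z.1 i < z.2), (z.2 - z.1 i) := by
      rw [Finset.sum_filter, Nat.cast_sum]
      refine Finset.sum_congr rfl fun i _ => ?_
      split_ifs <;> omega
    rw [Finset.sum_sub_distrib, Finset.sum_const, nsmul_eq_mul] at hsum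
    zify
    push_cast at hsum
    rw [hsum, ← hb]
    linarith)
  have hext : ∀ S ∈ L, ∃ C, IsMinVCover G C ∧ ∀ i ∈ S, i ∉ C :=
    fun S hS => exists_isMinVCover_disjoint (hL S hS)
  choose! f hfmin hf using hext
  have hle : ∀ i, ((L.map f).countP (i ∈ ·) : ℤ) ≤ z.1 i := by
    intro i
    have h1 : L.countP (i ∈ ·) ≤ L.countP (fun S => ¬ i ∈ f S) := by
      rw [Multiset.countP_eq_card_filter, Multiset.countP_eq_card_filter]
      refine Multiset.card_le_card (Multiset.le_filter.2 ⟨Multiset.filter_le _ _, ?_⟩)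
      intro S hS
      rw [Multiset.mem_filter] at hS
      exact hf S hS.1 i hS.2
    have h2 := Multiset.card_eq_countP_add_countP (fun S => i ∈ f S) L
    have h3 : (L.map f).countP (i ∈ ·) = L.countP (fun S => i ∈ f S) := by
      rw [Multiset.countP_map, Multiset.countP_eq_card_filter]
    have h4 := hLm i
    have h5 := ha i
    omega
  refine ⟨fun i => (z.1 i - (L.map f).countP (i ∈ ·)).toNat, fun C => (L.map f).count C,
    fun C hC => ?_, fun i => ?_, ?_⟩
  · obtain ⟨S, hS, rfl⟩ := Multiset.mem_map.1 (Multiset.count_ne_zero.1 hC)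
    exact hfmin S hS
  · rw [sum_count_mul_ite, Int.toNat_of_nonneg (sub_nonneg.2 (hle i))]
    ring
  · have h := Multiset.sum_count_eq_card (s := Finset.univ) (m := L.map f) (by simp)
    rw [Multiset.card_map, hLb] at h
    rw [hb, ← h]
    push_cast
    rfl

/-- Interior lattice points remain in `ℕA'` after subtracting the all-ones vector. -/
lemma IsPerfect.isNNCombA'_sub_one (hperf : IsPerfect G) {z : (Fin n → ℤ) × ℤ}
    (hz : ((fun i => (z.1 i : ℝ)), (z.2 : ℝ)) ∈ interior (reesCone G)) :
    IsNNCombA' G ((fun i => z.1 i - 1), z.2 - 1) := by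
  refine hperf.isNNCombA' fun K hK => ?_
  have h := clique_inequality_of_mem_interior_reesCone hz hK
  have h' : ((#K : ℤ) - 1) * z.2 < ∑ i ∈ K, z.1 i := by
    dsimp only at h
    exact_mod_cast h
  simp only [Finset.sum_sub_distrib, Finset.sum_const, nsmul_eq_mul]
  linarith

end ReesCone

/-- Let `G` be a perfect unmixed graph with no isolated
vertices and `J = I_c(G)`. Then `(1,…,1,1)` lies in the topological interior
of the Rees cone `ℝ₊(J)`; every integral vector `(a,b)` in the interior of
`ℝ₊(J)` satisfies `(a,b) − (1,…,1,1) ∈ ℝ₊(J) ∩ ℤ^{n+1}`; and the interior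
lattice points of `ℝ₊(J)` (i.e. the monomials `x^a t^b` generating the
canonical module) are exactly `(1,…,1,1) + w` with `w` running over the
lattice points `ℕA'` of the Rees cone (i.e. the multiples of `x_1⋯x_n t` by
monomials of the Rees algebra `R[Jt]`). -/
theorem interior_reesCone_of_perfect_unmixed {n : ℕ} (G : SimpleGraph (Fin n))
    (hiso : ∀ v : Fin n, ∃ w : Fin n, G.Adj v w)
    (hperf : IsPerfect G) (hunm : Unmixed G) :
    ((fun _ => (1 : ℝ)), (1 : ℝ)) ∈ interior (reesCone G) ∧
    (∀ z : (Fin n → ℤ) × ℤ,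
      ((fun i => (z.1 i : ℝ)), (z.2 : ℝ)) ∈ interior (reesCone G) →
      ((fun i => (z.1 i : ℝ) - 1), ((z.2 : ℝ) - 1)) ∈ reesCone G) ∧
    (∀ z : (Fin n → ℤ) × ℤ,
      ((fun i => (z.1 i : ℝ)), (z.2 : ℝ)) ∈ interior (reesCone G) ↔
      ∃ w : (Fin n → ℤ) × ℤ, IsNNCombA' G w ∧
        (∀ i, z.1 i = w.1 i + 1) ∧ z.2 = w.2 + 1) := by
  refine ⟨?_, fun z hz => ?_, fun z => ⟨fun hz => ?_, ?_⟩⟩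
  · have h0 : ((fun _ => 0, 0) : (Fin n → ℝ) × ℝ) ∈ reesCone G :=
      ⟨0, 0, by simp, by simp, by simp, by simp, by simp⟩
    simpa using add_one_mem_interior_reesCone h0
  · simpa using (hperf.isNNCombA'_sub_one hz).mem_reesCone
  · exact ⟨_, hperf.isNNCombA'_sub_one hz, by simp, by simp⟩
  · rintro ⟨w, hw, h1, h2⟩
    simpa [h1, h2] using add_one_mem_interior_reesCone hw.mem_reesCone
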